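/- Let V be a module with finite increasing filtration W, a refinement (M, φ) of W, and a finite decreasing filtration F. Then the following diagram of canonical isomorphisms commutes for all k, p: gr^F_p gr^M_k V → gr^F_p gr^M_k gr^W_{m(k)} V → gr^M_k gr^F_p gr^W_{m(k)} V → gr^M_k gr^W_{m(k)} gr^F_p V equals the composite gr^F_p gr^M_k V → gr^M_k gr^F_p V → gr^M_k gr^W_{m(k)} gr^F_p V, where the unlabeled maps are the isomorphisms induced by the refinement and the canonical switches of two filtrations. -/

import Mathlib

section GrPrelude
variable {R : Type*} [CommRing R]
variable {Q : Type*} [AddCommGroup Q] [Module R Q]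

/-- The subquotient `A / (A ∩ B)` of a module, for submodules `A B`. -/
abbrev GrSub (A B : Submodule R Q) := A ⧸ (B.comap A.subtype)

/-- The image of a submodule `T` in the subquotient `GrSub A B` (induced filtration). -/
def imgIn (A B T : Submodule R Q) : Submodule R (GrSub A B) :=
  Submodule.map (B.comap A.subtype).mkQ ((T ⊓ A).comap A.subtype)

variable {S : Type*} [AddCommGroup S] [Module R S]

/-- The canonical map into a subquotient induced by a map with values in `A`. -/
def stepMap (A B : Submodule R Q) (g : S →ₗ[R] Q) (hA : ∀ s, g s ∈ A) :
    S →ₗ[R] GrSub A B :=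
  (B.comap A.subtype).mkQ.comp (g.codRestrict A hA)

theorem stepMap_mem (A B T : Submodule R Q) (g : S →ₗ[R] Q) (hA : ∀ s, g s ∈ A)
    (hT : ∀ s, g s ∈ T) (s : S) : stepMap A B g hA s ∈ imgIn A B T :=
  Submodule.mem_map.mpr
    ⟨g.codRestrict A hA s, Submodule.mem_comap.mpr (Submodule.mem_inf.mpr ⟨hT s, hA s⟩), rfl⟩

end GrPrelude

section
variable {R : Type*} [CommRing R] {V : Type*} [AddCommGroup V] [Module R V]
variable (W M F : ℤ → Submodule R V) (k m p : ℤ)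

/-- Canonical surjection `F^p V ∩ M_k V → gr_F^p gr^M_k V`. -/
def p1 : (F p ⊓ M k : Submodule R V) →ₗ[R]
    GrSub (imgIn (M k) (M (k - 1)) (F p)) (imgIn (M k) (M (k - 1)) (F (p + 1))) :=
  stepMap _ _ (stepMap (M k) (M (k - 1)) (F p ⊓ M k).subtype (fun s => s.2.2))
    (stepMap_mem (M k) (M (k - 1)) (F p) (F p ⊓ M k).subtype (fun s => s.2.2)
      (fun s => s.2.1))

/-- Canonical surjection `F^p V ∩ M_k V → gr^M_k gr_F^p V`. -/
def p5 : (F p ⊓ M k : Submodule R V) →ₗ[R]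
    GrSub (imgIn (F p) (F (p + 1)) (M k)) (imgIn (F p) (F (p + 1)) (M (k - 1))) :=
  stepMap _ _ (stepMap (F p) (F (p + 1)) (F p ⊓ M k).subtype (fun s => s.2.1))
    (stepMap_mem (F p) (F (p + 1)) (M k) (F p ⊓ M k).subtype (fun s => s.2.1)
      (fun s => s.2.2))

variable (hMW : M k ≤ W m)

/-- Canonical surjection `F^p V ∩ M_k V → gr_F^p gr^M_k gr^W_m V`. -/
def p2 : (F p ⊓ M k : Submodule R V) →ₗ[R]
    GrSub
      (imgIn (imgIn (W m) (W (m - 1)) (M k)) (imgIn (W m) (W (m - 1)) (M (k - 1)))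
        (imgIn (W m) (W (m - 1)) (F p)))
      (imgIn (imgIn (W m) (W (m - 1)) (M k)) (imgIn (W m) (W (m - 1)) (M (k - 1)))
        (imgIn (W m) (W (m - 1)) (F (p + 1)))) :=
  stepMap _ _
    (stepMap (imgIn (W m) (W (m - 1)) (M k)) (imgIn (W m) (W (m - 1)) (M (k - 1)))
      (stepMap (W m) (W (m - 1)) (F p ⊓ M k).subtype (fun s => hMW s.2.2))
      (stepMap_mem (W m) (W (m - 1)) (M k) (F p ⊓ M k).subtype (fun s => hMW s.2.2)
        (fun s => s.2.2)))
    (stepMap_mem (imgIn (W m) (W (m - 1)) (M k)) (imgIn (W m) (W (m - 1)) (M (k - 1)))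
      (imgIn (W m) (W (m - 1)) (F p))
      (stepMap (W m) (W (m - 1)) (F p ⊓ M k).subtype (fun s => hMW s.2.2))
      (stepMap_mem (W m) (W (m - 1)) (M k) (F p ⊓ M k).subtype (fun s => hMW s.2.2)
        (fun s => s.2.2))
      (stepMap_mem (W m) (W (m - 1)) (F p) (F p ⊓ M k).subtype (fun s => hMW s.2.2)
        (fun s => s.2.1)))

/-- Canonical surjection `F^p V ∩ M_k V → gr^M_k gr_F^p gr^W_m V`. -/
def p3 : (F p ⊓ M k : Submodule R V) →ₗ[R]
    GrSub
      (imgIn (imgIn (W m) (W (m - 1)) (F p)) (imgIn (W m) (W (m - 1)) (F (p + 1)))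
        (imgIn (W m) (W (m - 1)) (M k)))
      (imgIn (imgIn (W m) (W (m - 1)) (F p)) (imgIn (W m) (W (m - 1)) (F (p + 1)))
        (imgIn (W m) (W (m - 1)) (M (k - 1)))) :=
  stepMap _ _
    (stepMap (imgIn (W m) (W (m - 1)) (F p)) (imgIn (W m) (W (m - 1)) (F (p + 1)))
      (stepMap (W m) (W (m - 1)) (F p ⊓ M k).subtype (fun s => hMW s.2.2))
      (stepMap_mem (W m) (W (m - 1)) (F p) (F p ⊓ M k).subtype (fun s => hMW s.2.2)
        (fun s => s.2.1)))
    (stepMap_mem (imgIn (W m) (W (m - 1)) (F p)) (imgIn (W m) (W (m - 1)) (F (p + 1)))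
      (imgIn (W m) (W (m - 1)) (M k))
      (stepMap (W m) (W (m - 1)) (F p ⊓ M k).subtype (fun s => hMW s.2.2))
      (stepMap_mem (W m) (W (m - 1)) (F p) (F p ⊓ M k).subtype (fun s => hMW s.2.2)
        (fun s => s.2.1))
      (stepMap_mem (W m) (W (m - 1)) (M k) (F p ⊓ M k).subtype (fun s => hMW s.2.2)
        (fun s => s.2.2)))

/-- Canonical surjection `F^p V ∩ M_k V → gr^M_k gr^W_m gr_F^p V`. -/
def p4 : (F p ⊓ M k : Submodule R V) →ₗ[R]
    GrSub
      (imgIn (imgIn (F p) (F (p + 1)) (W m)) (imgIn (F p) (F (p + 1)) (W (m - 1)))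
        (imgIn (F p) (F (p + 1)) (M k)))
      (imgIn (imgIn (F p) (F (p + 1)) (W m)) (imgIn (F p) (F (p + 1)) (W (m - 1)))
        (imgIn (F p) (F (p + 1)) (M (k - 1)))) :=
  stepMap _ _
    (stepMap (imgIn (F p) (F (p + 1)) (W m)) (imgIn (F p) (F (p + 1)) (W (m - 1)))
      (stepMap (F p) (F (p + 1)) (F p ⊓ M k).subtype (fun s => s.2.1))
      (stepMap_mem (F p) (F (p + 1)) (W m) (F p ⊓ M k).subtype (fun s => s.2.1)
        (fun s => hMW s.2.2)))
    (stepMap_mem (imgIn (F p) (F (p + 1)) (W m)) (imgIn (F p) (F (p + 1)) (W (m - 1)))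
      (imgIn (F p) (F (p + 1)) (M k))
      (stepMap (F p) (F (p + 1)) (F p ⊓ M k).subtype (fun s => s.2.1))
      (stepMap_mem (F p) (F (p + 1)) (W m) (F p ⊓ M k).subtype (fun s => s.2.1)
        (fun s => hMW s.2.2))
      (stepMap_mem (F p) (F (p + 1)) (M k) (F p ⊓ M k).subtype (fun s => s.2.1)
        (fun s => s.2.2)))

end

section GrLemmas
variable {R : Type*} [CommRing R]
variable {Q : Type*} [AddCommGroup Q] [Module R Q]
variable {S : Type*} [AddCommGroup S] [Module R S]

theorem stepMap_eq_zero_iff {A B : Submodule R Q} {g : S →ₗ[R] Q} {hA : ∀ s, g s ∈ A} {s : S} :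
    stepMap A B g hA s = 0 ↔ g s ∈ B :=
  Submodule.Quotient.mk_eq_zero _

theorem GrSub.exists_rep {A B : Submodule R Q} (y : GrSub A B) :
    ∃ a : A, (B.comap A.subtype).mkQ a = y :=
  Submodule.mkQ_surjective _ y

theorem mkQ_mem_imgIn_iff {A B T : Submodule R Q} {a : A} :
    (B.comap A.subtype).mkQ a ∈ imgIn A B T ↔ ∃ t ∈ T, t ∈ A ∧ (a : Q) - t ∈ B := by
  rw [imgIn, Submodule.mem_map]
  constructor
  · rintro ⟨t, ht, h⟩
    exact ⟨t, ht.1, ht.2, (Submodule.Quotient.eq (B.comap A.subtype)).1 h.symm⟩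
  · rintro ⟨t, ht, htA, h⟩
    exact ⟨⟨t, htA⟩, ⟨ht, htA⟩, ((Submodule.Quotient.eq (B.comap A.subtype)).2 h).symm⟩

theorem stepMap_mem_imgIn_iff {A B T : Submodule R Q} {g : S →ₗ[R] Q} {hA : ∀ s, g s ∈ A}
    {s : S} : stepMap A B g hA s ∈ imgIn A B T ↔ ∃ t ∈ T, t ∈ A ∧ g s - t ∈ B :=
  mkQ_mem_imgIn_iff

theorem stepMap_surjective {A B : Submodule R Q} {g : S →ₗ[R] Q} {hA : ∀ s, g s ∈ A}
    (h : ∀ a ∈ A, ∃ s, g s - a ∈ B) : Function.Surjective (stepMap A B g hA) := by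
  intro y
  obtain ⟨a, rfl⟩ := GrSub.exists_rep y
  obtain ⟨s, hs⟩ := h a a.2
  exact ⟨s, (Submodule.Quotient.eq _).2 hs⟩

/-- A map to an iterated subquotient is surjective as soon as representatives lift. -/
theorem stepMap_stepMap_surjective {A B T T' : Submodule R Q} {g : S →ₗ[R] Q}
    {hA : ∀ s, g s ∈ A} {hT : ∀ s, stepMap A B g hA s ∈ imgIn A B T}
    (h : ∀ t ∈ T, t ∈ A → ∃ s, g s - t ∈ B) :
    Function.Surjective (stepMap (imgIn A B T) (imgIn A B T') (stepMap A B g hA) hT) := by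
  refine stepMap_surjective fun y hy => ?_
  obtain ⟨t, ⟨htT, htA⟩, rfl⟩ := Submodule.mem_map.1 hy
  obtain ⟨s, hs⟩ := h t htT htA
  refine ⟨s, ?_⟩
  rw [show stepMap A B g hA s = (B.comap A.subtype).mkQ t from (Submodule.Quotient.eq _).2 hs,
    sub_self]
  exact zero_mem _

/-- A twice iterated version of `stepMap_stepMap_surjective`. -/
theorem stepMap_stepMap_stepMap_surjective {A B T T' U U' : Submodule R Q} {g : S →ₗ[R] Q}
    {hA : ∀ s, g s ∈ A} {hT : ∀ s, stepMap A B g hA s ∈ imgIn A B T}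
    {hU : ∀ s, stepMap (imgIn A B T) (imgIn A B T') (stepMap A B g hA) hT s ∈
      imgIn (imgIn A B T) (imgIn A B T') (imgIn A B U)}
    (h : ∀ u ∈ U, u ∈ A → ∀ t ∈ T, t ∈ A → u - t ∈ B → ∃ s, g s - u ∈ B) :
    Function.Surjective (stepMap (imgIn (imgIn A B T) (imgIn A B T') (imgIn A B U))
      (imgIn (imgIn A B T) (imgIn A B T') (imgIn A B U'))
      (stepMap (imgIn A B T) (imgIn A B T') (stepMap A B g hA) hT) hU) := by
  refine stepMap_stepMap_surjective fun y hy hyT => ?_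
  obtain ⟨u, ⟨huU, huA⟩, rfl⟩ := Submodule.mem_map.1 hy
  obtain ⟨t, htT, htA, hut⟩ := mkQ_mem_imgIn_iff.1 hyT
  obtain ⟨s, hs⟩ := h u huU huA t htT htA hut
  refine ⟨s, ?_⟩
  rw [show stepMap A B g hA s = (B.comap A.subtype).mkQ u from (Submodule.Quotient.eq _).2 hs,
    sub_self]
  exact zero_mem _

theorem stepMap_stepMap_eq_zero_iff {A B T T' : Submodule R Q} {g : S →ₗ[R] Q}
    {hA : ∀ s, g s ∈ A} {hT : ∀ s, stepMap A B g hA s ∈ imgIn A B T} {s : S} :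
    stepMap (imgIn A B T) (imgIn A B T') (stepMap A B g hA) hT s = 0 ↔
      ∃ t ∈ T', t ∈ A ∧ g s - t ∈ B :=
  stepMap_eq_zero_iff.trans stepMap_mem_imgIn_iff

theorem stepMap_stepMap_stepMap_eq_zero_iff {A B T T' U U' : Submodule R Q} {g : S →ₗ[R] Q}
    {hA : ∀ s, g s ∈ A} {hT : ∀ s, stepMap A B g hA s ∈ imgIn A B T}
    {hU : ∀ s, stepMap (imgIn A B T) (imgIn A B T') (stepMap A B g hA) hT s ∈
      imgIn (imgIn A B T) (imgIn A B T') (imgIn A B U)} {s : S} :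
    stepMap (imgIn (imgIn A B T) (imgIn A B T') (imgIn A B U))
      (imgIn (imgIn A B T) (imgIn A B T') (imgIn A B U'))
      (stepMap (imgIn A B T) (imgIn A B T') (stepMap A B g hA) hT) hU s = 0 ↔
      ∃ u ∈ U', u ∈ A ∧ (∃ t ∈ T, t ∈ A ∧ u - t ∈ B) ∧
        ∃ t ∈ T', t ∈ A ∧ g s - u - t ∈ B := by
  rw [stepMap_stepMap_eq_zero_iff]
  constructor
  · rintro ⟨y, hy, hyT, h⟩
    obtain ⟨u, ⟨huU, huA⟩, rfl⟩ := Submodule.mem_map.1 hy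
    exact ⟨u, huU, huA, mkQ_mem_imgIn_iff.1 hyT,
      (mkQ_mem_imgIn_iff (a := (⟨g s, hA s⟩ : A) - u)).1 h⟩
  · rintro ⟨u, huU, huA, hut, h⟩
    exact ⟨(B.comap A.subtype).mkQ ⟨u, huA⟩, Submodule.mem_map_of_mem ⟨huU, huA⟩,
      mkQ_mem_imgIn_iff.2 hut,
      (mkQ_mem_imgIn_iff (a := (⟨g s, hA s⟩ : A) - ⟨u, huA⟩)).2 h⟩

theorem LinearMap.exists_equiv_of_surjective_of_ker_eq {P N : Type*} [AddCommGroup P] [Module R P]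
    [AddCommGroup N] [Module R N] {f : S →ₗ[R] P} {g : S →ₗ[R] N}
    (hf : Function.Surjective f) (hg : Function.Surjective g)
    (h : LinearMap.ker f = LinearMap.ker g) : ∃ e : P ≃ₗ[R] N, ∀ s, e (f s) = g s := by
  refine ⟨(f.quotKerEquivOfSurjective hf).symm.trans
    ((Submodule.quotEquivOfEq _ _ h).trans (g.quotKerEquivOfSurjective hg)), fun s => ?_⟩
  have hs : (f.quotKerEquivOfSurjective hf).symm (f s) = Submodule.Quotient.mk s := by
    rw [LinearEquiv.symm_apply_eq]
    rfl
  rw [LinearEquiv.trans_apply, hs]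
  rfl

/-- Surjections with a common kernel have canonically isomorphic targets, and the pentagon of
these canonical isomorphisms commutes. -/
theorem LinearMap.exists_equiv_pentagon {P₁ P₂ P₃ P₄ P₅ : Type*}
    [AddCommGroup P₁] [Module R P₁] [AddCommGroup P₂] [Module R P₂] [AddCommGroup P₃] [Module R P₃]
    [AddCommGroup P₄] [Module R P₄] [AddCommGroup P₅] [Module R P₅]
    {f₁ : S →ₗ[R] P₁} {f₂ : S →ₗ[R] P₂} {f₃ : S →ₗ[R] P₃} {f₄ : S →ₗ[R] P₄} {f₅ : S →ₗ[R] P₅}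
    (h₁ : Function.Surjective f₁) (h₂ : Function.Surjective f₂) (h₃ : Function.Surjective f₃)
    (h₄ : Function.Surjective f₄) (h₅ : Function.Surjective f₅) {C : S → Prop}
    (k₁ : ∀ s, s ∈ LinearMap.ker f₁ ↔ C s) (k₂ : ∀ s, s ∈ LinearMap.ker f₂ ↔ C s)
    (k₃ : ∀ s, s ∈ LinearMap.ker f₃ ↔ C s) (k₄ : ∀ s, s ∈ LinearMap.ker f₄ ↔ C s)
    (k₅ : ∀ s, s ∈ LinearMap.ker f₅ ↔ C s) :
    ∃ (e1 : P₁ ≃ₗ[R] P₂) (e3 : P₂ ≃ₗ[R] P₃) (e4 : P₃ ≃ₗ[R] P₄) (e2 : P₁ ≃ₗ[R] P₅)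
      (e5 : P₅ ≃ₗ[R] P₄),
      (∀ s, e1 (f₁ s) = f₂ s) ∧ (∀ s, e3 (f₂ s) = f₃ s) ∧ (∀ s, e4 (f₃ s) = f₄ s) ∧
      (∀ s, e2 (f₁ s) = f₅ s) ∧ (∀ s, e5 (f₅ s) = f₄ s) ∧ ∀ x, e4 (e3 (e1 x)) = e5 (e2 x) := by
  obtain ⟨e1, he1⟩ := exists_equiv_of_surjective_of_ker_eq h₁ h₂
    (Submodule.ext fun s => (k₁ s).trans (k₂ s).symm)
  obtain ⟨e3, he3⟩ := exists_equiv_of_surjective_of_ker_eq h₂ h₃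
    (Submodule.ext fun s => (k₂ s).trans (k₃ s).symm)
  obtain ⟨e4, he4⟩ := exists_equiv_of_surjective_of_ker_eq h₃ h₄
    (Submodule.ext fun s => (k₃ s).trans (k₄ s).symm)
  obtain ⟨e2, he2⟩ := exists_equiv_of_surjective_of_ker_eq h₁ h₅
    (Submodule.ext fun s => (k₁ s).trans (k₅ s).symm)
  obtain ⟨e5, he5⟩ := exists_equiv_of_surjective_of_ker_eq h₅ h₄
    (Submodule.ext fun s => (k₅ s).trans (k₄ s).symm)
  refine ⟨e1, e3, e4, e2, e5, he1, he3, he4, he2, he5, fun x => ?_⟩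
  obtain ⟨s, rfl⟩ := h₁ x
  rw [he1, he3, he4, he2, he5]

end GrLemmas

section CanonicalSurjections
variable {R : Type*} [CommRing R] {V : Type*} [AddCommGroup V] [Module R V]
variable {W M F : ℤ → Submodule R V} {k m p : ℤ}

theorem p1_surjective : Function.Surjective (p1 M F k p) :=
  stepMap_stepMap_surjective fun t ht htA => ⟨⟨t, ht, htA⟩, by simp⟩

theorem p5_surjective : Function.Surjective (p5 M F k p) :=
  stepMap_stepMap_surjective fun t ht htA => ⟨⟨t, htA, ht⟩, by simp⟩

theorem p2_surjective (hMW : M k ≤ W m) (hWM : W (m - 1) ≤ M k) :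
    Function.Surjective (p2 W M F k m p hMW) :=
  stepMap_stepMap_stepMap_surjective fun u hu _ t ht _ hut =>
    ⟨⟨u, hu, by simpa using add_mem (hWM hut) ht⟩, by simp⟩

theorem p3_surjective (hMW : M k ≤ W m) (hWM : W (m - 1) ≤ M k) :
    Function.Surjective (p3 W M F k m p hMW) :=
  stepMap_stepMap_stepMap_surjective fun u hu _ t ht _ hut =>
    ⟨⟨t, ht, by simpa using sub_mem hu (hWM hut)⟩, by simpa using neg_mem hut⟩

theorem p4_surjective (hMW : M k ≤ W m) :
    Function.Surjective (p4 W M F k m p hMW) :=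
  stepMap_stepMap_stepMap_surjective fun u hu huA _ _ _ _ => ⟨⟨u, huA, hu⟩, by simp⟩

theorem mem_ker_p1_iff {s : (F p ⊓ M k : Submodule R V)} (hM : M (k - 1) ≤ M k) :
    s ∈ LinearMap.ker (p1 M F k p) ↔ ∃ t ∈ F (p + 1), (s : V) - t ∈ M (k - 1) := by
  refine stepMap_stepMap_eq_zero_iff.trans ⟨fun ⟨t, ht, _, h⟩ => ⟨t, ht, h⟩, ?_⟩
  rintro ⟨t, ht, h⟩
  exact ⟨t, ht, by simpa using sub_mem s.2.2 (hM h), h⟩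

theorem mem_ker_p5_iff {s : (F p ⊓ M k : Submodule R V)} (hF : F (p + 1) ≤ F p) :
    s ∈ LinearMap.ker (p5 M F k p) ↔ ∃ t ∈ F (p + 1), (s : V) - t ∈ M (k - 1) := by
  refine stepMap_stepMap_eq_zero_iff.trans ⟨?_, ?_⟩
  · rintro ⟨t, ht, _, h⟩
    exact ⟨s - t, h, by simpa using ht⟩
  · rintro ⟨t, ht, h⟩
    exact ⟨s - t, h, sub_mem s.2.1 (hF ht), by simpa using ht⟩

theorem mem_ker_p2_iff (hMW : M k ≤ W m) {s : (F p ⊓ M k : Submodule R V)}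
    (hM : M (k - 1) ≤ M k) (hWM : W (m - 1) ≤ M (k - 1)) :
    s ∈ LinearMap.ker (p2 W M F k m p hMW) ↔ ∃ t ∈ F (p + 1), (s : V) - t ∈ M (k - 1) := by
  refine stepMap_stepMap_stepMap_eq_zero_iff.trans ⟨?_, ?_⟩
  · rintro ⟨u, hu, _, _, t, ht, _, h⟩
    exact ⟨u, hu, by simpa using add_mem (hWM h) ht⟩
  · rintro ⟨t, ht, h⟩
    have htM : t ∈ M k := by simpa using sub_mem s.2.2 (hM h)
    exact ⟨t, ht, hMW htM, ⟨t, htM, hMW htM, by simp⟩, s - t, h, hMW (hM h), by simp⟩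

theorem mem_ker_p3_iff (hMW : M k ≤ W m) {s : (F p ⊓ M k : Submodule R V)}
    (hF : F (p + 1) ≤ F p) (hM : M (k - 1) ≤ M k) (hWM : W (m - 1) ≤ M (k - 1)) :
    s ∈ LinearMap.ker (p3 W M F k m p hMW) ↔ ∃ t ∈ F (p + 1), (s : V) - t ∈ M (k - 1) := by
  refine stepMap_stepMap_stepMap_eq_zero_iff.trans ⟨?_, ?_⟩
  · rintro ⟨u, hu, _, _, t, ht, _, h⟩
    refine ⟨t, ht, ?_⟩
    have := add_mem (hWM h) hu
    rwa [sub_right_comm, sub_add_cancel] at this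
  · rintro ⟨t, ht, h⟩
    have htM : t ∈ M k := by simpa using sub_mem s.2.2 (hM h)
    exact ⟨s - t, h, hMW (hM h), ⟨s - t, sub_mem s.2.1 (hF ht), hMW (hM h), by simp⟩,
      t, ht, hMW htM, by simp⟩

theorem mem_ker_p4_iff (hMW : M k ≤ W m) {s : (F p ⊓ M k : Submodule R V)}
    (hF : F (p + 1) ≤ F p) (hM : M (k - 1) ≤ M k) (hWM : W (m - 1) ≤ M (k - 1)) :
    s ∈ LinearMap.ker (p4 W M F k m p hMW) ↔ ∃ t ∈ F (p + 1), (s : V) - t ∈ M (k - 1) := by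
  refine stepMap_stepMap_stepMap_eq_zero_iff.trans ⟨?_, ?_⟩
  · rintro ⟨u, hu, _, _, t, ht, _, h⟩
    refine ⟨_, h, ?_⟩
    simpa [sub_sub] using add_mem hu (hWM ht)
  · rintro ⟨t, ht, h⟩
    have hst : (s : V) - t ∈ F p := sub_mem s.2.1 (hF ht)
    exact ⟨s - t, h, hst, ⟨s - t, hMW (hM h), hst, by simp⟩, 0, zero_mem _, zero_mem _,
      by simpa using ht⟩

end CanonicalSurjections

section
variable {R : Type*} [CommRing R] {V : Type*} [AddCommGroup V] [Module R V]
variable (W M F : ℤ → Submodule R V) (k m p : ℤ)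
variable (hMW : M k ≤ W m)

/-- Corollary 1.14 (cor:1): for a refinement `(M, φ)` of a finite increasing filtration
`W`, a finite decreasing filtration `F` and `m = m(k)`, the pentagon of canonical
isomorphisms
`gr_F^p gr^M_k V → gr_F^p gr^M_k gr^W_m V → gr^M_k gr_F^p gr^W_m V → gr^M_k gr^W_m gr_F^p V`
and `gr_F^p gr^M_k V → gr^M_k gr_F^p V → gr^M_k gr^W_m gr_F^p V` commutes; each
canonical isomorphism is characterized by compatibility with the canonical surjections
from `F^p V ∩ M_k V`. -/
theorem stmt5 (hW : Monotone W) (hM : Monotone M)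
    (hWbot : ∃ a, W a = ⊥) (hWtop : ∃ b, W b = ⊤)
    (hMbot : ∃ a, M a = ⊥) (hMtop : ∃ b, M b = ⊤)
    (hF : Antitone F) (hFbot : ∃ a, F a = ⊥) (hFtop : ∃ b, F b = ⊤)
    (φ : ℤ → ℤ) (hφ : StrictMono φ) (href : ∀ m, W m = M (φ m))
    (h1 : φ (m - 1) < k) (h2 : k ≤ φ m) (hMW : M k ≤ W m) :
    ∃ (e1 : _ ≃ₗ[R] _) (e3 : _ ≃ₗ[R] _) (e4 : _ ≃ₗ[R] _) (e2 : _ ≃ₗ[R] _)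
      (e5 : _ ≃ₗ[R] _),
      (∀ s, e1 (p1 M F k p s) = p2 W M F k m p hMW s) ∧
      (∀ s, e3 (p2 W M F k m p hMW s) = p3 W M F k m p hMW s) ∧
      (∀ s, e4 (p3 W M F k m p hMW s) = p4 W M F k m p hMW s) ∧
      (∀ s, e2 (p1 M F k p s) = p5 M F k p s) ∧
      (∀ s, e5 (p5 M F k p s) = p4 W M F k m p hMW s) ∧
      ∀ x, e4 (e3 (e1 x)) = e5 (e2 x) := by
  have hMk : M (k - 1) ≤ M k := hM (by lia)
  have hWM : W (m - 1) ≤ M (k - 1) := href (m - 1) ▸ hM (by lia)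
  have hFp : F (p + 1) ≤ F p := hF (by lia)
  exact LinearMap.exists_equiv_pentagon p1_surjective (p2_surjective hMW (hWM.trans hMk))
    (p3_surjective hMW (hWM.trans hMk)) (p4_surjective hMW) p5_surjective
    (fun _ => mem_ker_p1_iff hMk) (fun _ => mem_ker_p2_iff hMW hMk hWM)
    (fun _ => mem_ker_p3_iff hMW hFp hMk hWM) (fun _ => mem_ker_p4_iff hMW hFp hMk hWM)
    (fun _ => mem_ker_p5_iff hFp)

end
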